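/- arXiv:0903.0116 — 5 statements merged into one kernel-verified Lean document; each statement's English description precedes it below -/
import Mathlib

section
/- In a tournament tree, consider the winner's path: the path from the root obtained by repeatedly descending to the designated winner child, ending at a leaf (the overall winner). The number of fair matches on this path, i.e., the number of internal nodes on the path whose two children have equal ranks, is at most the rank of the root. Consequently, if the winner's path contains u unfair matches, the total number of matches won by the overall winner is at most u plus the rank of the root. -/
/-- A tournament tree: a full binary tree whose leaves are the items.
Each node carries a natural-number rank; each internal node has a
designated winner child and a loser child. -/
inductive Tourn : Type
  | leaf (rank : ℕ)
  | node (rank : ℕ) (winner loser : Tourn)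

namespace Tourn

/-- The rank of (the root of) a tournament tree. -/
def rank : Tourn → ℕ
  | leaf r => r
  | node r _ _ => r

/-- Validity of the rank labeling. -/
def Valid : Tourn → Prop
  | leaf r => r = 0
  | node r w l =>
      Valid w ∧ Valid l ∧
      (if w.rank = l.rank then r = w.rank + 1
       else w.rank ≤ r ∧ r ≤ max w.rank l.rank)

/-- The number of fair matches (internal nodes with equal-rank children)
on the winner's path, i.e. the path from the root that repeatedly descends
to the winner child. -/
def pathFair : Tourn → ℕ
  | leaf _ => 0
  | node _ w l => (if w.rank = l.rank then 1 else 0) + pathFair w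

/-- The number of unfair matches (internal nodes whose children have distinct
ranks) on the winner's path. -/
def pathUnfair : Tourn → ℕ
  | leaf _ => 0
  | node _ w l => (if w.rank = l.rank then 0 else 1) + pathUnfair w

/-- The total number of matches on the winner's path, i.e. the number of
matches won by the overall winner. -/
def pathMatches : Tourn → ℕ
  | leaf _ => 0
  | node _ w _ => 1 + pathMatches w

end Tourn

namespace Tourn

/-- Every match on the winner's path is either fair or unfair. -/
theorem pathMatches_eq_pathUnfair_add_pathFair (t : Tourn) :
    t.pathMatches = t.pathUnfair + t.pathFair := by
  induction t with
  | leaf r => rfl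
  | node r w l ihw _ =>
    simp only [pathMatches, pathUnfair, pathFair]
    split_ifs <;> omega

theorem Valid.pathFair_le_rank {t : Tourn} (ht : t.Valid) : t.pathFair ≤ t.rank := by
  induction t with
  | leaf r => exact Nat.zero_le r
  | node r w l ihw _ =>
    obtain ⟨hw, -, hr⟩ := ht
    have := ihw hw
    simp only [pathFair]
    change _ ≤ r
    split_ifs at hr ⊢ <;> omega

end Tourn

/-- The number of fair matches on the winner's path is at most the rank of the
root; consequently the total number of matches won by the overall winner is at
most the number of unfair matches on the path plus the rank of the root. -/
theorem winner_path_fair_matches_le_rank (t : Tourn) (ht : t.Valid) :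
    t.pathFair ≤ t.rank ∧ t.pathMatches ≤ t.pathUnfair + t.rank := by
  refine ⟨ht.pathFair_le_rank, ?_⟩
  rw [t.pathMatches_eq_pathUnfair_add_pathFair]
  exact Nat.add_le_add_left ht.pathFair_le_rank _
end

section
/- A type-1 half tree whose root has rank k contains at least 2^k nodes. -/
/-- A (possibly empty) binary tree in which every node carries an integer
rank. A missing child (`nil`) is assigned rank `-1`. -/
inductive HTree : Type
  | nil
  | node (rank : ℤ) (left right : HTree)

namespace HTree

/-- The rank of the root; a missing tree has rank `-1`. -/
def rank : HTree → ℤ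
  | nil => -1
  | node r _ _ => r

/-- The number of nodes. -/
def size : HTree → ℕ
  | nil => 0
  | node _ a b => size a + size b + 1

/-- The type-1 rank rule for non-root nodes: the rank differences of the two
(possibly missing) children are either 1 and 1, or 0 and at least 1. -/
def Valid1 : HTree → Prop
  | nil => True
  | node r a b =>
      Valid1 a ∧ Valid1 b ∧
      ((r - a.rank = 1 ∧ r - b.rank = 1) ∨
       (r - a.rank = 0 ∧ 1 ≤ r - b.rank) ∨
       (r - b.rank = 0 ∧ 1 ≤ r - a.rank))

/-- A type-1 half tree: the root has at most one child, the root's rank is one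
more than the rank of its (possibly missing) child, and every non-root node
obeys the type-1 rank rule. -/
def IsHalfTree1 : HTree → Prop
  | node r c nil => Valid1 c ∧ r = c.rank + 1
  | _ => False

end HTree

/-- A tree obeying the type-1 rank rule whose rank is `k - 1` has at least `2 ^ k - 1` nodes. -/
theorem HTree.Valid1.two_pow_le_size_add_one {t : HTree} (ht : t.Valid1) {k : ℕ}
    (hk : t.rank + 1 = k) : 2 ^ k ≤ t.size + 1 := by
  induction t generalizing k with
  | nil =>
    obtain rfl : k = 0 := by
      simp only [rank] at hk
      omega
    simp
  | node r a b iha ihb =>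
    obtain ⟨ha, hb, h⟩ := ht
    simp only [rank] at hk
    simp only [size]
    rcases h with ⟨h₁, h₂⟩ | ⟨h₁, -⟩ | ⟨h₁, -⟩
    · cases k with
      | zero => simp
      | succ k =>
        push_cast at hk
        have h₃ := iha ha (k := k) (by omega)
        have h₄ := ihb hb (k := k) (by omega)
        rw [pow_succ]
        omega
    · have := iha ha (k := k) (by omega)
      omega
    · have := ihb hb (k := k) (by omega)
      omega

/-- A type-1 half tree whose root has rank `k` contains at least `2^k` nodes. -/
theorem type1_halfTree_size_ge_two_pow_rank (t : HTree) (k : ℕ)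
    (ht : t.IsHalfTree1) (hk : t.rank = (k : ℤ)) :
    2 ^ k ≤ t.size := by
  match t, ht with
  | .node r c .nil, ⟨hc, hr⟩ => exact hc.two_pow_le_size_add_one (hr.symm.trans hk)
end

section
/- In a type-1 half tree with n nodes, every node has rank at most log₂ n; in particular only ⌈lg lg n⌉ bits per node are needed to store ranks in a type-1 rank-pairing heap. -/
namespace HTree

/-- The list of ranks of all (actual) nodes. -/
def ranks : HTree → List ℤ
  | nil => []
  | node r a b => r :: (ranks a ++ ranks b)

end HTree

namespace HTree

/-- Ranks do not increase on the way down a valid tree. -/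
theorem Valid1.le_rank {t : HTree} (ht : t.Valid1) : ∀ r ∈ t.ranks, r ≤ t.rank := by
  induction t with
  | nil => simp [ranks]
  | node k a b iha ihb =>
    obtain ⟨ha, hb, h⟩ := ht
    intro r hr
    simp only [ranks, List.mem_cons, List.mem_append] at hr
    simp only [rank]
    rcases hr with rfl | hr | hr
    · exact le_rfl
    · have := iha ha r hr
      omega
    · have := ihb hb r hr
      omega

/-- A valid tree whose root has rank `k` has at least `2 ^ (k + 1) - 1` nodes. -/
theorem Valid1.two_zpow_le_size {t : HTree} (ht : t.Valid1) :
    (2 : ℝ) ^ (t.rank + 1) ≤ t.size + 1 := by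
  induction t with
  | nil => simp [rank, size]
  | node k a b iha ihb =>
    obtain ⟨ha, hb, h⟩ := ht
    have ha' := iha ha
    have hb' := ihb hb
    have hsa : (0 : ℝ) ≤ a.size := Nat.cast_nonneg _
    have hsb : (0 : ℝ) ≤ b.size := Nat.cast_nonneg _
    simp only [rank, size]
    push_cast
    rcases h with ⟨h₁, h₂⟩ | ⟨h₁, -⟩ | ⟨h₁, -⟩
    · rw [show a.rank + 1 = k by omega] at ha'
      rw [show b.rank + 1 = k by omega] at hb'
      rw [zpow_add_one₀ two_ne_zero]
      linarith
    · rw [show a.rank = k by omega] at ha'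
      linarith
    · rw [show b.rank = k by omega] at hb'
      linarith

end HTree

/-- In a type-1 half tree with `n` nodes, every node has rank at most `log₂ n`. -/
theorem type1_halfTree_rank_le_log (t : HTree) (n : ℕ)
    (ht : t.IsHalfTree1) (hn : t.size = n) :
    ∀ r ∈ t.ranks, (r : ℝ) ≤ Real.logb 2 (n : ℝ) := by
  match t, ht with
  | .node k c .nil, ⟨hc, hk⟩ =>
    intro r hr
    have hrk : r ≤ k := by
      simp only [HTree.ranks, List.append_nil, List.mem_cons] at hr
      rcases hr with rfl | hr
      · exact le_rfl
      · have := hc.le_rank r hr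
        omega
    have hsize : (2 : ℝ) ^ k ≤ n := by
      rw [← hn, hk]
      simpa [HTree.size] using hc.two_zpow_le_size
    have hpos : (0 : ℝ) < n := lt_of_lt_of_le (by positivity) hsize
    rw [Real.le_logb_iff_rpow_le one_lt_two hpos, Real.rpow_intCast]
    exact (zpow_le_zpow_right₀ one_le_two hrk).trans hsize
end

section
/- A type-2 half tree whose root has rank k contains at least F_{k+2} nodes, where F denotes the Fibonacci sequence with F_0 = 0, F_1 = 1, F_{m+2} = F_{m+1} + F_m; consequently it contains at least φ^k nodes, where φ = (1 + √5)/2 is the golden ratio. -/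
namespace HTree

/-- The type-2 rank rule for non-root nodes: the rank differences of the two
(possibly missing) children are either 1 and 1, or 1 and 2, or 0 and at
least 2. -/
def Valid2 : HTree → Prop
  | nil => True
  | node r a b =>
      Valid2 a ∧ Valid2 b ∧
      ((r - a.rank = 1 ∧ r - b.rank = 1) ∨
       (r - a.rank = 1 ∧ r - b.rank = 2) ∨
       (r - a.rank = 2 ∧ r - b.rank = 1) ∨
       (r - a.rank = 0 ∧ 2 ≤ r - b.rank) ∨
       (r - b.rank = 0 ∧ 2 ≤ r - a.rank))

/-- A type-2 half tree: the root has at most one child, the root's rank is one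
more than the rank of its (possibly missing) child, and every non-root node
obeys the type-2 rank rule. -/
def IsHalfTree2 : HTree → Prop
  | node r c nil => Valid2 c ∧ r = c.rank + 1
  | _ => False

end HTree

namespace HTree

theorem Valid2.neg_one_le_rank {t : HTree} (h : t.Valid2) : -1 ≤ t.rank := by
  induction t with
  | nil => simp [rank]
  | node r a b iha ihb =>
    obtain ⟨ha, hb, hr⟩ := h
    have := iha ha
    have := ihb hb
    simp only [rank]
    omega

theorem Valid2.fib_le_size_succ {t : HTree} (h : t.Valid2) (n : ℕ)
    (hn : t.rank + 1 = n) : Nat.fib (n + 2) ≤ t.size + 1 := by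
  induction t generalizing n with
  | nil =>
    obtain rfl : n = 0 := by simp only [rank] at hn; omega
    simp [size]
  | node r a b iha ihb =>
    obtain ⟨ha, hb, hr⟩ := h
    have har := ha.neg_one_le_rank
    have hbr := hb.neg_one_le_rank
    simp only [rank] at hn
    simp only [size]
    obtain ⟨m, rfl⟩ : ∃ m, n = m + 1 := ⟨n - 1, by omega⟩
    have hfib : Nat.fib (m + 1 + 2) = Nat.fib (m + 1) + Nat.fib (m + 2) := Nat.fib_add_two
    have hmono : Nat.fib (m + 1) ≤ Nat.fib (m + 2) := Nat.fib_mono (by omega)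
    rcases hr with ⟨h₁, h₂⟩ | ⟨h₁, h₂⟩ | ⟨h₁, h₂⟩ | ⟨h₁, -⟩ | ⟨h₁, -⟩
    · have := iha ha m (by omega)
      have := ihb hb m (by omega)
      omega
    · obtain ⟨l, rfl⟩ : ∃ l, m = l + 1 := ⟨m - 1, by omega⟩
      have := iha ha (l + 1) (by omega)
      have : Nat.fib (l + 1 + 1) ≤ b.size + 1 := ihb hb l (by omega)
      omega
    · obtain ⟨l, rfl⟩ : ∃ l, m = l + 1 := ⟨m - 1, by omega⟩
      have : Nat.fib (l + 1 + 1) ≤ a.size + 1 := iha ha l (by omega)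
      have := ihb hb (l + 1) (by omega)
      omega
    · have := iha ha (m + 1) (by omega)
      omega
    · have := ihb hb (m + 1) (by omega)
      omega

end HTree

theorem goldenRatio_pow_le_fib_add_two (k : ℕ) :
    Real.goldenRatio ^ k ≤ (Nat.fib (k + 2) : ℝ) := by
  induction k using Nat.twoStepInduction with
  | zero => simp
  | one => simpa [Nat.fib_add_two] using Real.goldenRatio_lt_two.le
  | more k h₀ h₁ =>
    have hfib : (Nat.fib (k + 2 + 2) : ℝ) = Nat.fib (k + 2) + Nat.fib (k + 1 + 2) := by
      rw [Nat.fib_add_two (n := k + 2), Nat.cast_add]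
    rw [hfib, pow_add, Real.goldenRatio_sq, mul_add, mul_one, ← pow_succ]
    linarith

/-- A type-2 half tree whose root has rank `k` contains at least `F_{k+2}`
nodes, where `F` is the Fibonacci sequence; consequently it contains at least
`φ^k` nodes, where `φ = (1 + √5)/2` is the golden ratio. -/
theorem type2_halfTree_size_ge_fib (t : HTree) (k : ℕ)
    (ht : t.IsHalfTree2) (hk : t.rank = (k : ℤ)) :
    Nat.fib (k + 2) ≤ t.size ∧
      ((1 + Real.sqrt 5) / 2) ^ k ≤ (t.size : ℝ) := by
  have hfib : Nat.fib (k + 2) ≤ t.size := by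
    match t, ht with
    | .node r c .nil, ⟨hc, hr⟩ =>
      simp only [HTree.rank] at hk
      simpa [HTree.size] using hc.fib_le_size_succ k (by omega)
  exact ⟨hfib, (goldenRatio_pow_le_fib_add_two k).trans (by exact_mod_cast hfib)⟩
end

section
/- In a type-2 half tree with n nodes, every node has rank at most log_φ n, where φ = (1 + √5)/2 is the golden ratio; in particular the maximum rank for a given heap size in a type-2 rank-pairing heap is the same as in a Fibonacci heap, namely at most log_φ n. -/
namespace HTree

theorem Valid2.le_rank_of_mem_ranks {t : HTree} (ht : t.Valid2) :
    ∀ r ∈ t.ranks, r ≤ t.rank := by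
  induction t with
  | nil => simp [ranks]
  | node k a b iha ihb =>
    obtain ⟨ha, hb, hk⟩ := ht
    intro r hr
    simp only [ranks, List.mem_cons, List.mem_append] at hr
    simp only [rank]
    rcases hr with rfl | hr | hr
    · exact le_rfl
    · have := iha ha r hr
      omega
    · have := ihb hb r hr
      omega

theorem Valid2.goldenRatio_zpow_rank_le {t : HTree} (ht : t.Valid2) :
    Real.goldenRatio ^ (t.rank + 1) ≤ (t.size : ℝ) + 1 := by
  induction t with
  | nil => simp [rank, size]
  | node k a b iha ihb =>
    obtain ⟨ha, hb, hk⟩ := ht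
    have iha := iha ha
    have ihb := ihb hb
    have hφ := Real.goldenRatio_pos
    have hpos : 0 < Real.goldenRatio ^ (k - 1) := zpow_pos hφ _
    have h₀ : Real.goldenRatio ^ k = Real.goldenRatio ^ (k - 1) * Real.goldenRatio := by
      rw [← zpow_add_one₀ hφ.ne', sub_add_cancel]
    have h₁ : Real.goldenRatio ^ (k + 1) = Real.goldenRatio ^ k + Real.goldenRatio ^ (k - 1) := by
      rw [zpow_add_one₀ hφ.ne', h₀, mul_assoc, ← sq, Real.goldenRatio_sq]
      ring
    have hle : Real.goldenRatio ^ (k - 1) ≤ Real.goldenRatio ^ k :=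
      zpow_le_zpow_right₀ Real.one_lt_goldenRatio.le (by omega)
    simp only [rank, size, Nat.cast_add, Nat.cast_one]
    have hsa : (0 : ℝ) ≤ a.size := Nat.cast_nonneg _
    have hsb : (0 : ℝ) ≤ b.size := Nat.cast_nonneg _
    rcases hk with ⟨h, h'⟩ | ⟨h, h'⟩ | ⟨h, h'⟩ | ⟨h, -⟩ | ⟨h, -⟩
    · rw [show a.rank + 1 = k by omega] at iha
      rw [show b.rank + 1 = k by omega] at ihb
      linarith
    · rw [show a.rank + 1 = k by omega] at iha
      rw [show b.rank + 1 = k - 1 by omega] at ihb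
      linarith
    · rw [show a.rank + 1 = k - 1 by omega] at iha
      rw [show b.rank + 1 = k by omega] at ihb
      linarith
    · rw [show a.rank + 1 = k + 1 by omega] at iha
      linarith
    · rw [show b.rank + 1 = k + 1 by omega] at ihb
      linarith

end HTree

/-- In a type-2 half tree with `n` nodes, every node has rank at most
`log_φ n`, where `φ = (1 + √5)/2` is the golden ratio. -/
theorem type2_halfTree_rank_le_logb_goldenRatio (t : HTree) (n : ℕ)
    (ht : t.IsHalfTree2) (hn : t.size = n) :
    ∀ r ∈ t.ranks, (r : ℝ) ≤ Real.logb ((1 + Real.sqrt 5) / 2) (n : ℝ) := by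
  subst hn
  match t, ht with
  | .node k c .nil, ⟨hc, hk⟩ =>
    intro r hr
    have hrk : r ≤ c.rank + 1 := by
      simp only [HTree.ranks, List.append_nil, List.mem_cons] at hr
      rcases hr with rfl | hr
      · exact hk.le
      · have := hc.le_rank_of_mem_ranks r hr
        omega
    change (r : ℝ) ≤ Real.logb Real.goldenRatio _
    have hsize : (((HTree.node k c .nil).size : ℕ) : ℝ) = (c.size : ℝ) + 1 := by
      simp [HTree.size]
    rw [hsize, Real.le_logb_iff_rpow_le Real.one_lt_goldenRatio (by positivity),
      Real.rpow_intCast]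
    exact (zpow_le_zpow_right₀ Real.one_lt_goldenRatio.le hrk).trans hc.goldenRatio_zpow_rank_le
end
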